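/- Let G be a countable group acting ergodically by measure-preserving Borel bijections on a standard probability space (X, μ). If C ⊆ B ⊆ X are Borel sets with μ(B) > 0 and μ(C) = μ(B)/n for some n ∈ ℕ, then there is a partition ξ of B into n Borel pieces, each measurable with respect to σ_G({C, B}), with each piece having measure μ(B)/n and with C ∈ ξ. -/

import Mathlib

open MeasureTheory Real ENNReal

section Defs

variable {X : Type*} {mX : MeasurableSpace X}

/-- The smallest `G`-invariant sub-σ-algebra containing the collection `C`
(together with `X`) and all `μ`-null sets. -/
def sigmaG (G : Type*) [Group G] [MulAction G X] (μ : Measure X) (C : Set (Set X)) :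
    MeasurableSpace X :=
  sInf {m : MeasurableSpace X |
    (∀ S ∈ C, MeasurableSet[m] S) ∧
    (∀ S : Set X, MeasurableSet[m] S → ∀ g : G, MeasurableSet[m] ((fun x => g • x) ⁻¹' S)) ∧
    (∀ S : Set X, μ S = 0 → MeasurableSet[m] S)}

/-- The action of `G` on `(X, μ)` is by measure-preserving (Borel) bijections. -/
def IsPmpAction (G : Type*) [Group G] [MulAction G X] (μ : Measure X) : Prop :=
  ∀ g : G, @MeasurePreserving X X mX mX (fun x : X => g • x) μ μ

/-- The action is ergodic: every `G`-invariant Borel set is null or conull. -/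
def IsErgodicAction (G : Type*) [Group G] [MulAction G X] (μ : Measure X) : Prop :=
  ∀ A : Set X, MeasurableSet[mX] A → (∀ g : G, (fun x => g • x) ⁻¹' A = A) →
    μ A = 0 ∨ μ A = 1

/-- A countable Borel partition (as an indexed family): measurable, pairwise
disjoint sets whose union is conull. -/
def IsPartition {ι : Type*} (μ : Measure X) (A : ι → Set X) : Prop :=
  (∀ i, MeasurableSet[mX] (A i)) ∧ Pairwise (Function.onFun Disjoint A) ∧ μ (⋃ i, A i) = 1

/-- The partition is generating: `σ_G(A)` is the full Borel σ-algebra (up to null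
sets; `σ_G(A)` contains all null sets, so this is containment of the Borel sets). -/
def IsGenerating (G : Type*) [Group G] [MulAction G X] {ι : Type*} (μ : Measure X)
    (A : ι → Set X) : Prop :=
  mX ≤ sigmaG G μ (Set.range A)

/-- Shannon entropy of a countable partition, valued in `ℝ≥0∞`. -/
noncomputable def partitionEntropy {ι : Type*} (μ : Measure X) (A : ι → Set X) : ℝ≥0∞ :=
  ∑' i, ENNReal.ofReal (negMulLog (μ (A i)).toReal)

/-- Shannon entropy of a (finite or countable) probability vector, valued in `ℝ≥0∞`. -/
noncomputable def vecEntropy {ι : Type*} (p : ι → ℝ) : ℝ≥0∞ :=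
  ∑' i, ENNReal.ofReal (negMulLog (p i))

/-- Rokhlin entropy: the infimum of the Shannon entropies of countable Borel
generating partitions. -/
noncomputable def rokhlinEntropy (G : Type*) [Group G] [MulAction G X] (μ : Measure X) :
    ℝ≥0∞ :=
  ⨅ (A : ℕ → Set X) (_ : IsPartition μ A ∧ IsGenerating G μ A), partitionEntropy μ A

end Defs

/-- Prepending a set disjoint from every member of a disjoint family keeps the family disjoint. -/
theorem pairwise_disjoint_fin_cons {X : Type*} {k : ℕ} {E : Set X} {D : Fin k → Set X}
    (hD : Pairwise (Function.onFun Disjoint D)) (hE : ∀ i, Disjoint E (D i)) :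
    Pairwise (Function.onFun Disjoint (Fin.cons E D : Fin (k + 1) → Set X)) := by
  intro i j hij
  cases i using Fin.cases <;> cases j using Fin.cases
  · exact absurd rfl hij
  · exact hE _
  · exact (hE _).symm
  · exact hD fun h => hij (congrArg Fin.succ h)

/-- The σ-algebra `sigmaG` is invariant under the action. -/
theorem measurableSet_sigmaG_preimage_smul {X : Type*} {mX : MeasurableSpace X} {G : Type*}
    [Group G] [MulAction G X] {μ : Measure X} {C : Set (Set X)} {S : Set X}
    (hS : MeasurableSet[sigmaG G μ C] S) (g : G) :
    MeasurableSet[sigmaG G μ C] ((fun x => g • x) ⁻¹' S) :=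
  MeasurableSpace.measurableSet_sInf.2 fun m hm =>
    hm.2.1 S (MeasurableSpace.measurableSet_sInf.1 hS m hm) g

/-- Members of `C` are measurable with respect to `sigmaG G μ C`. -/
theorem measurableSet_sigmaG_of_mem {X : Type*} {mX : MeasurableSpace X} {G : Type*}
    [Group G] [MulAction G X] {μ : Measure X} {C : Set (Set X)} {S : Set X} (hS : S ∈ C) :
    MeasurableSet[sigmaG G μ C] S :=
  MeasurableSpace.measurableSet_sInf.2 fun _ hm => hm.1 S hS

/-- In an ergodic p.m.p. action, a set `B` which is at least as large as `A` contains a set of the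
same measure as `A`, which can be taken in any invariant sub-σ-algebra containing `A` and `B`. -/
theorem exists_subset_measure_eq_of_ergodic {X : Type*} {m mX : MeasurableSpace X} (hm : m ≤ mX)
    {G : Type*} [Group G] [Countable G] [MulAction G X]
    {μ : Measure[mX] X} [IsProbabilityMeasure μ]
    (hpmp : IsPmpAction G μ) (herg : IsErgodicAction G μ)
    (hinv : ∀ S, MeasurableSet[m] S → ∀ g : G, MeasurableSet[m] ((fun x => g • x) ⁻¹' S))
    {A B : Set X} (hA : MeasurableSet[m] A) (hB : MeasurableSet[m] B) (hAB : μ A ≤ μ B) :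
    ∃ E, MeasurableSet[m] E ∧ E ⊆ B ∧ μ E = μ A := by
  obtain ⟨e, he⟩ := exists_surjective_nat G
  -- Remove greedily from `A` and `B` the parts matched by the successive group elements.
  let P : ℕ → Set X × Set X := fun k => Nat.rec (A, B) (fun j p =>
    (p.1 \ (fun x => e j • x) ⁻¹' p.2, p.2 \ (fun x => (e j)⁻¹ • x) ⁻¹' p.1)) k
  have hP1 (k : ℕ) : (P (k + 1)).1 = (P k).1 \ (fun x => e k • x) ⁻¹' (P k).2 := rfl
  have hP2 (k : ℕ) : (P (k + 1)).2 = (P k).2 \ (fun x => (e k)⁻¹ • x) ⁻¹' (P k).1 := rfl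
  have hPm (k : ℕ) : MeasurableSet[m] (P k).1 ∧ MeasurableSet[m] (P k).2 := by
    induction k with
    | zero => exact ⟨hA, hB⟩
    | succ k ih =>
      exact ⟨MeasurableSet.diff ih.1 (hinv _ ih.2 _), MeasurableSet.diff ih.2 (hinv _ ih.1 _)⟩
  have hbalance (k : ℕ) : μ (P k).1 + μ B = μ (P k).2 + μ A := by
    induction k with
    | zero => exact add_comm _ _
    | succ k ih =>
      have hmatch : μ ((P k).1 ∩ (fun x => e k • x) ⁻¹' (P k).2) =
          μ ((P k).2 ∩ (fun x => (e k)⁻¹ • x) ⁻¹' (P k).1) := by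
        rw [← (hpmp (e k)).measure_preimage (hm _
          (MeasurableSet.inter (hPm k).2 (hinv _ (hPm k).1 _))).nullMeasurableSet]
        congr 1
        ext x
        simp [and_comm]
      have h1 := measure_sdiff_add_inter (μ := μ) (P k).1 (hm _ (hinv _ (hPm k).2 (e k)))
      have h2 := measure_sdiff_add_inter (μ := μ) (P k).2 (hm _ (hinv _ (hPm k).1 (e k)⁻¹))
      rw [← hP1] at h1
      rw [← hP2, ← hmatch] at h2
      rw [← h1, ← h2, add_right_comm, add_right_comm _ _ (μ A)] at ih
      exact (ENNReal.add_left_inj (measure_ne_top _ _)).1 ih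
  have hanti1 : Antitone fun k => (P k).1 := antitone_nat_of_succ_le fun k => by
    rw [hP1]; exact Set.sdiff_subset
  have hanti2 : Antitone fun k => (P k).2 := antitone_nat_of_succ_le fun k => by
    rw [hP2]; exact Set.sdiff_subset
  set A' := ⋂ k, (P k).1
  set B' := ⋂ k, (P k).2
  have hA'm : MeasurableSet[m] A' := MeasurableSet.iInter fun k => (hPm k).1
  have hB'm : MeasurableSet[m] B' := MeasurableSet.iInter fun k => (hPm k).2
  have hlim : μ A' + μ B = μ B' + μ A := by
    have t1 := tendsto_measure_iInter_atTop (μ := μ)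
      (fun k => (hm _ (hPm k).1).nullMeasurableSet) hanti1 ⟨0, measure_ne_top _ _⟩
    have t2 := tendsto_measure_iInter_atTop (μ := μ)
      (fun k => (hm _ (hPm k).2).nullMeasurableSet) hanti2 ⟨0, measure_ne_top _ _⟩
    refine tendsto_nhds_unique (t1.add_const (μ B)) ?_
    simpa only [Function.comp_def, hbalance] using t2.add_const (μ A)
  have hdisj (g : G) (x : X) (hx : x ∈ A') (hgx : g • x ∈ B') : False := by
    obtain ⟨k, rfl⟩ := he g
    have h := Set.mem_iInter.1 hx (k + 1)
    rw [hP1] at h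
    exact h.2 (Set.mem_iInter.1 hgx k)
  have hA'0 : μ A' = 0 := by
    have hS : MeasurableSet[mX] (⋃ g : G, (fun x => g • x) ⁻¹' A') :=
      MeasurableSet.iUnion fun g => hm _ (hinv _ hA'm g)
    have hsub : A' ⊆ ⋃ g : G, (fun x => g • x) ⁻¹' A' :=
      fun x hx => Set.mem_iUnion.2 ⟨1, by simpa using hx⟩
    rcases herg _ hS fun g => by
        ext x
        simp only [Set.mem_preimage, Set.mem_iUnion, smul_smul]
        exact ((Equiv.mulRight g).surjective.exists (p := fun h => h • x ∈ A')).symm with h | h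
    · exact measure_mono_null hsub h
    · have hB'0 : μ B' = 0 := by
        refine measure_mono_null (fun x hx => ?_) ((prob_compl_eq_zero_iff hS).2 h)
        intro hxS
        obtain ⟨g, hg⟩ := Set.mem_iUnion.1 hxS
        exact hdisj g⁻¹ (g • x) hg (by simpa using hx)
      rw [hB'0, zero_add] at hlim
      refine le_antisymm ?_ bot_le
      refine (ENNReal.add_le_add_iff_right (measure_ne_top μ B)).1 ?_
      rw [hlim, zero_add]
      exact hAB
  have hB'B : B' ⊆ B := Set.iInter_subset _ 0
  refine ⟨B \ B', MeasurableSet.diff hB hB'm, Set.sdiff_subset, ?_⟩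
  rw [measure_sdiff hB'B (hm _ hB'm).nullMeasurableSet (measure_ne_top _ _)]
  rw [hA'0, zero_add] at hlim
  rw [hlim, ENNReal.add_sub_cancel_left (measure_ne_top _ _)]

/-- In an ergodic p.m.p. action, if `k * μ A ≤ μ B` then `B` contains `k` disjoint sets of the same
measure as `A`, lying in any given invariant sub-σ-algebra containing `A` and `B`. -/
theorem exists_disjoint_subsets_measure_eq_of_ergodic {X : Type*} {m mX : MeasurableSpace X}
    (hm : m ≤ mX) {G : Type*} [Group G] [Countable G] [MulAction G X]
    {μ : Measure[mX] X} [IsProbabilityMeasure μ]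
    (hpmp : IsPmpAction G μ) (herg : IsErgodicAction G μ)
    (hinv : ∀ S, MeasurableSet[m] S → ∀ g : G, MeasurableSet[m] ((fun x => g • x) ⁻¹' S))
    {A B : Set X} (hA : MeasurableSet[m] A) (hB : MeasurableSet[m] B)
    (k : ℕ) (hAB : k * μ A ≤ μ B) :
    ∃ D : Fin k → Set X, (∀ i, MeasurableSet[m] (D i)) ∧ (∀ i, D i ⊆ B) ∧
      Pairwise (Function.onFun Disjoint D) ∧ ∀ i, μ (D i) = μ A := by
  induction k generalizing B with
  | zero => exact ⟨fun _ => ∅, fun i => i.elim0, fun i => i.elim0, fun i => i.elim0,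
      fun i => i.elim0⟩
  | succ k ih =>
    rw [Nat.cast_add_one, add_mul, one_mul] at hAB
    obtain ⟨E, hE, hEB, hμE⟩ := exists_subset_measure_eq_of_ergodic hm hpmp herg hinv hA hB
      (le_add_self.trans hAB)
    obtain ⟨D, hD, hDB, hdisj, hμD⟩ := ih (MeasurableSet.diff hB hE) (by
      rw [measure_sdiff hEB (hm _ hE).nullMeasurableSet (measure_ne_top _ _), hμE]
      exact ENNReal.le_sub_of_add_le_right (measure_ne_top _ _) hAB)
    refine ⟨Fin.cons E D, Fin.cases hE hD, Fin.cases hEB fun i => (hDB i).trans Set.sdiff_subset,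
      ?_, Fin.cases hμE hμD⟩
    exact pairwise_disjoint_fin_cons hdisj fun i => Set.disjoint_left.2
      fun x hxE hxD => (hDB i hxD).2 hxE

/-- **Corollary (dividing a set into pieces of equal measure).** If
`C ⊆ B ⊆ X` with `μ(C) = μ(B)/n`, then there is a `σ_G({C,B})`-measurable
partition of `B` (mod null) into `n` pieces, each of measure `μ(B)/n`, one of
which is `C`. -/
theorem exists_equal_measure_partition
    {X : Type*} [mX : MeasurableSpace X] [StandardBorelSpace X]
    (G : Type*) [Group G] [Countable G] [MulAction G X]
    (μ : Measure X) [IsProbabilityMeasure μ]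
    (hpmp : IsPmpAction G μ) (herg : IsErgodicAction G μ)
    (C B : Set X) (hC : MeasurableSet[mX] C) (hB : MeasurableSet[mX] B)
    (hCB : C ⊆ B) (hBpos : 0 < μ B)
    (n : ℕ) (hn : 0 < n) (hmeas : μ C = μ B / n) :
    ∃ D : Fin n → Set X,
      (∀ i, MeasurableSet[sigmaG G μ {C, B}] (D i)) ∧
      (∀ i, D i ⊆ B) ∧
      Pairwise (Function.onFun Disjoint D) ∧
      μ (B \ ⋃ i, D i) = 0 ∧
      (∀ i, μ (D i) = μ B / n) ∧
      D ⟨0, hn⟩ = C := by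
  obtain ⟨k, rfl⟩ : ∃ k, n = k + 1 := ⟨n - 1, by omega⟩
  have hinf (S : Set X) : MeasurableSet[mX ⊓ sigmaG G μ {C, B}] S ↔
      MeasurableSet[mX] S ∧ MeasurableSet[sigmaG G μ {C, B}] S :=
    MeasurableSpace.measurableSet_inf
  have hC' : MeasurableSet[mX ⊓ sigmaG G μ {C, B}] C :=
    (hinf C).2 ⟨hC, measurableSet_sigmaG_of_mem (by simp)⟩
  have hB' : MeasurableSet[mX ⊓ sigmaG G μ {C, B}] B :=
    (hinf B).2 ⟨hB, measurableSet_sigmaG_of_mem (by simp)⟩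
  have htotal : ((k + 1 : ℕ) : ℝ≥0∞) * μ C = μ B := by
    rw [hmeas]
    exact ENNReal.mul_div_cancel (by simp) (ENNReal.natCast_ne_top _)
  obtain ⟨D, hD, hDB, hdisj, hμD⟩ := exists_disjoint_subsets_measure_eq_of_ergodic
    (m := mX ⊓ sigmaG G μ {C, B}) inf_le_left hpmp herg
    (fun S hS g => (hinf _).2 ⟨(hpmp g).measurable ((hinf S).1 hS).1,
      measurableSet_sigmaG_preimage_smul ((hinf S).1 hS).2 g⟩)
    hC' (MeasurableSet.diff hB' hC') k (by
      rw [measure_sdiff hCB hC.nullMeasurableSet (measure_ne_top _ _), ← htotal,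
        Nat.cast_add_one, add_mul, one_mul, ENNReal.add_sub_cancel_right (measure_ne_top _ _)])
  let F : Fin (k + 1) → Set X := Fin.cons C D
  have hF (i : Fin (k + 1)) : MeasurableSet[mX ⊓ sigmaG G μ {C, B}] (F i) :=
    Fin.cases hC' hD i
  have hFB (i : Fin (k + 1)) : F i ⊆ B :=
    Fin.cases hCB (fun i => (hDB i).trans Set.sdiff_subset) i
  have hFdisj : Pairwise (Function.onFun Disjoint F) :=
    pairwise_disjoint_fin_cons hdisj fun i => Set.disjoint_left.2
      fun x hxC hxD => (hDB i hxD).2 hxC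
  have hFμ (i : Fin (k + 1)) : μ (F i) = μ C := Fin.cases rfl hμD i
  refine ⟨F, fun i => ((hinf _).1 (hF i)).2, hFB, hFdisj, ?_, fun i => (hFμ i).trans hmeas, rfl⟩
  have hFm (i : Fin (k + 1)) : MeasurableSet (F i) := ((hinf _).1 (hF i)).1
  rw [measure_sdiff (Set.iUnion_subset hFB) (MeasurableSet.iUnion hFm).nullMeasurableSet
    (measure_ne_top _ _), measure_iUnion hFdisj hFm, tsum_fintype]
  simp only [hFμ, Finset.sum_const, Finset.card_univ, Fintype.card_fin, nsmul_eq_mul]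
  rw [htotal, tsub_self]
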